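/- arXiv:2004.07023 — 5 statements merged into one kernel-verified Lean document; each statement's English description precedes it below -/
import Mathlib

section
/- For every continuous compactly supported function φ : ℝ^d → ℝ, one has ε^{−(d−1)/2} |□(0)|^{−1} ∫_{Ω̃_ε} φ(z) dz → ∫_ℝ φ(z₁, 0) dz₁ as ε → 0, where Ω̃_ε = ε^{−1/2} Ω_ε = { z ∈ ℝ^d : √ε z ∈ Ω_ε } and 0 denotes the origin of ℝ^{d−1}. Equivalently, the measures dμ_ε(z) = ε^{−(d−1)/2}|□(0)|^{−1} χ_{Ω̃_ε}(z) dz converge weak-* in the space of Radon measures to dz₁ × δ(z'). -/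
open MeasureTheory Set Filter Topology

noncomputable section

/-- The thin domain `Ω_ε = { x : x₁ ∈ I, x'/ε ∈ Q(x₁, x₁/ε) }`, where
`Q(x₁,y₁) = { y' : F x₁ y₁ y' > 0 }` and `I = (-1/2, 1/2)`. -/
def thinDomain (k : ℕ) (F : ℝ → ℝ → (Fin k → ℝ) → ℝ) (ε : ℝ) :
    Set (Fin (k+1) → ℝ) :=
  {x | x 0 ∈ Ioo (-(1/2) : ℝ) (1/2) ∧ 0 < F (x 0) (x 0 / ε) (fun i => x i.succ / ε)}

/-- The periodicity cell `□(x₁) = { (y₁,y') ∈ [0,1) × ℝ^{d-1} : F x₁ y₁ y' > 0 }`. -/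
def cell (k : ℕ) (F : ℝ → ℝ → (Fin k → ℝ) → ℝ) (x₁ : ℝ) : Set (Fin (k+1) → ℝ) :=
  {y | y 0 ∈ Ico (0:ℝ) 1 ∧ 0 < F x₁ (y 0) (fun i => y i.succ)}

/-- Fubini's theorem on `Fin (k + 1) → ℝ`, splitting off the first coordinate. -/
theorem integral_fin_succ_eq_integral_cons {k : ℕ} {f : (Fin (k + 1) → ℝ) → ℝ}
    (hf : Integrable f) :
    ∫ z, f z = ∫ t : ℝ, ∫ y : Fin k → ℝ, f (Fin.cons t y) := by
  have hmp := (volume_preserving_piFinSuccAbove (fun _ : Fin (k + 1) => ℝ) 0).symm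
  have hcons : ∀ p : ℝ × (Fin k → ℝ),
      (MeasurableEquiv.piFinSuccAbove (fun _ : Fin (k + 1) => ℝ) 0).symm p
        = Fin.cons p.1 p.2 := fun p => by
    simp [MeasurableEquiv.piFinSuccAbove, Fin.insertNthEquiv]
  have hint : Integrable
      (fun p => f ((MeasurableEquiv.piFinSuccAbove (fun _ : Fin (k + 1) => ℝ) 0).symm p)) :=
    (hmp.integrable_comp_emb (MeasurableEquiv.measurableEmbedding _)).2 hf
  rw [← hmp.integral_comp' f, Measure.volume_eq_prod, integral_prod _ hint]
  simp only [hcons]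

/-- A continuous function, periodic in its last variable and vanishing for large second variable,
is bounded uniformly for the first variable in `[0, 1]`. -/
theorem exists_bound_of_periodic {G : ℝ → ℝ → ℝ → ℝ}
    (hG : Continuous fun p : ℝ × ℝ × ℝ => G p.1 p.2.1 p.2.2)
    (hper : ∀ η t, Function.Periodic (G η t) 1) {M : ℝ}
    (hsupp : ∀ η t y, M < |t| → G η t y = 0) :
    ∃ C, 0 ≤ C ∧ ∀ η ∈ Icc (0 : ℝ) 1, ∀ t y, |G η t y| ≤ C := by
  obtain ⟨C, hC⟩ := ((isCompact_Icc (a := (0 : ℝ)) (b := 1)).prod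
    ((isCompact_Icc (a := -M) (b := M)).prod
      (isCompact_Icc (a := (0 : ℝ)) (b := 1)))).exists_bound_of_continuousOn hG.continuousOn
  refine ⟨max C 0, le_max_right _ _, fun η hη t y => ?_⟩
  by_cases ht : M < |t|
  · simp [hsupp η t y ht]
  · have hfr : G η t (Int.fract y) = G η t y := by
      have := (hper η t).sub_int_mul_eq (x := y) ⌊y⌋
      rwa [mul_one] at this
    rw [← hfr]
    exact (hC (η, t, Int.fract y) ⟨hη, abs_le.1 (not_lt.1 ht),
      Int.fract_nonneg y, (Int.fract_lt_one y).le⟩).trans (le_max_left _ _)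

/-- A bound for a translate, by less than one, of a bounded function supported in `[-M, M]`. -/
theorem abs_translate_le_indicator {g : ℝ → ℝ} {C M : ℝ} (hC : ∀ t, |g t| ≤ C)
    (hsupp : ∀ t, M < |t| → g t = 0) {t r : ℝ} (hr0 : 0 ≤ r) (hr1 : r ≤ 1) :
    |g (t + r)| ≤ (Icc (-(M + 1)) (M + 1)).indicator (fun _ => C) t := by
  by_cases ht : t ∈ Icc (-(M + 1)) (M + 1)
  · rw [indicator_of_mem ht]
    exact hC _
  · have : M < |t + r| := by
      by_contra! hle
      rw [abs_le] at hle
      exact ht ⟨by linarith, by linarith⟩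
    rw [indicator_of_notMem ht, hsupp _ this, abs_zero]

/-- Averaging over a period: `∫ G η t (t / η) dt` can be rewritten as an integral of cell
averages. -/
theorem integral_oscillating_eq {G : ℝ → ℝ → ℝ → ℝ}
    (hG : Continuous fun p : ℝ × ℝ × ℝ => G p.1 p.2.1 p.2.2)
    (hper : ∀ η t, Function.Periodic (G η t) 1) {M : ℝ}
    (hsupp : ∀ η t y, M < |t| → G η t y = 0) {η : ℝ} (hη : 0 < η) (hη1 : η ≤ 1) :
    ∫ t, G η t (t / η) = ∫ t, ∫ s in (0 : ℝ)..1, G η (t + η * s) (t / η + s) := by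
  obtain ⟨C, hC0, hC⟩ := exists_bound_of_periodic hG hper hsupp
  have hshift : ∀ s : ℝ, ∫ t, G η (t + η * s) (t / η + s) = ∫ t, G η t (t / η) := fun s => by
    rw [← integral_add_right_eq_self (fun t => G η t (t / η)) (η * s)]
    refine integral_congr_ae (ae_of_all _ fun t => ?_)
    simp only
    congr 1
    field_simp
  rw [← intervalIntegral_integral_swap]
  · simp [hshift]
  · have hb : Integrable (fun p : ℝ × ℝ => (Icc (-(M + 1)) (M + 1)).indicator (fun _ => C) p.2)
        ((volume.restrict (uIoc (0 : ℝ) 1)).prod volume) :=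
      have : IsFiniteMeasure (volume.restrict (uIoc (0 : ℝ) 1)) :=
        ⟨by simp⟩
      Integrable.comp_snd (f := (Icc (-(M + 1)) (M + 1)).indicator fun _ => C)
        ((integrable_indicator_iff measurableSet_Icc).2 (integrableOn_const (by simp))) _
    refine hb.mono' ?_ ?_
    · refine Continuous.aestronglyMeasurable ?_
      exact hG.comp (by fun_prop : Continuous fun p : ℝ × ℝ =>
        ((η, p.2 + η * p.1, p.2 / η + p.1) : ℝ × ℝ × ℝ))
    · have hr : (volume.restrict (uIoc (0 : ℝ) 1)).prod (volume : Measure ℝ)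
          = (volume.prod volume).restrict (uIoc (0 : ℝ) 1 ×ˢ univ) := by
        rw [← Measure.prod_restrict, Measure.restrict_univ]
      rw [hr]
      refine ae_restrict_of_forall_mem (measurableSet_uIoc.prod MeasurableSet.univ) ?_
      rintro ⟨s, t⟩ ⟨hs, -⟩
      rw [uIoc_of_le zero_le_one] at hs
      exact abs_translate_le_indicator (g := fun t' => G η t' (t / η + s))
        (fun t' => hC η ⟨hη.le, hη1⟩ t' _) (fun t' => hsupp η t' _)
        (mul_nonneg hη.le hs.1.le) (mul_le_one₀ hη1 hs.1.le hs.2)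

/-- Integrals of functions oscillating periodically at scale `η` converge to the integral of the
mean over a period. -/
theorem tendsto_integral_oscillating {G : ℝ → ℝ → ℝ → ℝ}
    (hG : Continuous fun p : ℝ × ℝ × ℝ => G p.1 p.2.1 p.2.2)
    (hper : ∀ η t, Function.Periodic (G η t) 1) {M : ℝ}
    (hsupp : ∀ η t y, M < |t| → G η t y = 0) :
    Tendsto (fun η => ∫ t, G η t (t / η)) (𝓝[>] 0)
      (𝓝 (∫ t, ∫ s in (0 : ℝ)..1, G 0 t s)) := by
  obtain ⟨C, hC0, hC⟩ := exists_bound_of_periodic hG hper hsupp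
  have hη01 : ∀ᶠ η : ℝ in 𝓝[>] 0, η ∈ Ioc (0 : ℝ) 1 :=
    Ioc_mem_nhdsGT zero_lt_one
  have hcont : ∀ η : ℝ, Continuous fun p : ℝ × ℝ =>
      G η (p.1 + η * p.2) (p.1 / η + p.2) := fun η =>
    hG.comp (by fun_prop : Continuous fun p : ℝ × ℝ =>
      ((η, p.1 + η * p.2, p.1 / η + p.2) : ℝ × ℝ × ℝ))
  have key : Tendsto
      (fun η => ∫ t, ∫ s in (0 : ℝ)..1, G η (t + η * s) (t / η + s)) (𝓝[>] 0)
      (𝓝 (∫ t, ∫ s in (0 : ℝ)..1, G 0 t s)) := by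
    refine tendsto_integral_filter_of_dominated_convergence
      ((Icc (-(M + 1)) (M + 1)).indicator fun _ => C) ?_ ?_ ?_ ?_
    · refine Eventually.of_forall fun η => Continuous.aestronglyMeasurable ?_
      exact intervalIntegral.continuous_parametric_intervalIntegral_of_continuous' (hcont η) 0 1
    · filter_upwards [hη01] with η hη
      refine ae_of_all _ fun t => ?_
      refine (intervalIntegral.norm_integral_le_of_norm_le_const
        (C := (Icc (-(M + 1)) (M + 1)).indicator (fun _ => C) t) fun s hs => ?_).trans (by simp)
      rw [uIoc_of_le zero_le_one] at hs
      exact abs_translate_le_indicator (g := fun t' => G η t' (t / η + s))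
        (fun t' => hC η ⟨hη.1.le, hη.2⟩ t' _) (fun t' => hsupp η t' _)
        (mul_nonneg hη.1.le hs.1.le) (mul_le_one₀ hη.2 hs.1.le hs.2)
    · exact (integrable_indicator_iff measurableSet_Icc).2 (integrableOn_const (by simp))
    · refine ae_of_all _ fun t => ?_
      rw [Metric.tendsto_nhds]
      intro δ hδ
      have hunif : ∀ᶠ η : ℝ in 𝓝 0, ∀ p ∈ Icc (0 : ℝ) 1 ×ˢ Icc (0 : ℝ) 1,
          |G η (t + η * p.1) p.2 - G 0 t p.2| < δ / 2 := by
        refine (isCompact_Icc.prod isCompact_Icc).eventually_forall_of_forall_eventually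
          (P := fun (η : ℝ) (p : ℝ × ℝ) => |G η (t + η * p.1) p.2 - G 0 t p.2| < δ / 2) ?_
        intro p _
        have hc1 : Continuous fun q : ℝ × ℝ × ℝ => G q.1 (t + q.1 * q.2.1) q.2.2 :=
          hG.comp (by fun_prop : Continuous fun q : ℝ × ℝ × ℝ =>
            ((q.1, t + q.1 * q.2.1, q.2.2) : ℝ × ℝ × ℝ))
        have hc2 : Continuous fun q : ℝ × ℝ × ℝ => G 0 t q.2.2 :=
          hG.comp (by fun_prop : Continuous fun q : ℝ × ℝ × ℝ =>
            ((0, t, q.2.2) : ℝ × ℝ × ℝ))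
        refine (hc1.sub hc2).abs.continuousAt.eventually_lt continuousAt_const ?_
        simpa using half_pos hδ
      filter_upwards [nhdsWithin_le_nhds hunif] with η hη
      have hmean : ∫ s in (0 : ℝ)..1, G 0 t s = ∫ s in (0 : ℝ)..1, G 0 t (t / η + s) := by
        rw [intervalIntegral.integral_comp_add_left (fun s => G 0 t s)]
        simpa using ((hper 0 t).intervalIntegral_add_eq (t / η) 0).symm
      have hc1 : Continuous fun s : ℝ => G η (t + η * s) (t / η + s) :=
        (hcont η).comp (by fun_prop : Continuous fun s : ℝ => ((t, s) : ℝ × ℝ))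
      have hc2 : Continuous fun s : ℝ => G 0 t (t / η + s) :=
        hG.comp (by fun_prop : Continuous fun s : ℝ => ((0, t, t / η + s) : ℝ × ℝ × ℝ))
      rw [hmean, Real.dist_eq, ← intervalIntegral.integral_sub
        (hc1.intervalIntegrable _ _) (hc2.intervalIntegrable _ _), ← Real.norm_eq_abs]
      refine lt_of_le_of_lt (intervalIntegral.norm_integral_le_of_norm_le_const
        (C := δ / 2) fun s hs => ?_) (by simpa using half_lt_self hδ)
      rw [uIoc_of_le zero_le_one] at hs
      have hfr : ∀ η' t', G η' t' (Int.fract (t / η + s)) = G η' t' (t / η + s) :=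
        fun η' t' => by
          have := (hper η' t').sub_int_mul_eq (x := t / η + s) ⌊t / η + s⌋
          rwa [mul_one] at this
      have := hη (s, Int.fract (t / η + s)) ⟨⟨hs.1.le, hs.2⟩,
        Int.fract_nonneg _, (Int.fract_lt_one _).le⟩
      simp only [hfr] at this
      exact this.le
  refine key.congr' ?_
  filter_upwards [hη01] with η hη
  exact (integral_oscillating_eq hG hper hsupp hη.1 hη.2).symm

/-- The integral of `φ` over the rescaled slice `{ η a : F (η t) y a > 0 }`, normalised by the
scale: `∫_{F (η t) y a > 0} φ (t, η a) da`. -/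
def sliceIntegral (k : ℕ) (F : ℝ → ℝ → (Fin k → ℝ) → ℝ) (φ : (Fin (k + 1) → ℝ) → ℝ)
    (η t y : ℝ) : ℝ :=
  ∫ a : Fin k → ℝ, {a | 0 < F (η * t) y a}.indicator (fun a => φ (Fin.cons t (η • a))) a

theorem continuous_sliceIntegral {k : ℕ} {F : ℝ → ℝ → (Fin k → ℝ) → ℝ}
    (hF : Continuous fun p : ℝ × ℝ × (Fin k → ℝ) => F p.1 p.2.1 p.2.2)
    {R : ℝ} (hQbdd : ∀ x₁ y₁ y', 0 < F x₁ y₁ y' → ‖y'‖ < R)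
    (hnull : ∀ x₁ y₁ : ℝ, volume {y' : Fin k → ℝ | F x₁ y₁ y' = 0} = 0)
    {φ : (Fin (k + 1) → ℝ) → ℝ} (hφ : Continuous φ) (hφc : HasCompactSupport φ) :
    Continuous fun p : ℝ × ℝ × ℝ => sliceIntegral k F φ p.1 p.2.1 p.2.2 := by
  obtain ⟨C, hC⟩ := hφ.bounded_above_of_compact_support hφc
  have hφ' : Continuous fun q : (ℝ × ℝ × ℝ) × (Fin k → ℝ) =>
      φ (Fin.cons q.1.2.1 (q.1.1 • q.2)) := by
    refine hφ.comp (continuous_pi fun i => ?_)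
    refine Fin.cases ?_ (fun j => ?_) i
    · simp only [Fin.cons_zero]; fun_prop
    · simp only [Fin.cons_succ, Pi.smul_apply]; fun_prop
  have hF' : Continuous fun q : (ℝ × ℝ × ℝ) × (Fin k → ℝ) => F (q.1.1 * q.1.2.1) q.1.2.2 q.2 :=
    hF.comp (by fun_prop : Continuous fun q : (ℝ × ℝ × ℝ) × (Fin k → ℝ) =>
      ((q.1.1 * q.1.2.1, q.1.2.2, q.2) : ℝ × ℝ × (Fin k → ℝ)))
  refine continuous_iff_continuousAt.2 fun p₀ => ?_
  refine continuousAt_of_dominated (bound := (Metric.ball 0 R).indicator fun _ => C) ?_ ?_ ?_ ?_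
  · refine Eventually.of_forall fun p => ?_
    have h1 : Continuous fun a : Fin k → ℝ => F (p.1 * p.2.1) p.2.2 a :=
      hF'.comp (by fun_prop : Continuous fun a : Fin k → ℝ => (p, a))
    have h2 : Continuous fun a : Fin k → ℝ => φ (Fin.cons p.2.1 (p.1 • a)) :=
      hφ'.comp (by fun_prop : Continuous fun a : Fin k → ℝ => (p, a))
    exact h2.aestronglyMeasurable.indicator (isOpen_lt continuous_const h1).measurableSet
  · refine Eventually.of_forall fun p => ae_of_all _ fun a => ?_
    by_cases ha : 0 < F (p.1 * p.2.1) p.2.2 a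
    · rw [indicator_of_mem (show a ∈ {a | 0 < F (p.1 * p.2.1) p.2.2 a} from ha),
        indicator_of_mem (by simpa using hQbdd _ _ _ ha)]
      exact hC _
    · rw [indicator_of_notMem (show a ∉ {a | 0 < F (p.1 * p.2.1) p.2.2 a} from ha), norm_zero]
      exact indicator_nonneg (fun _ _ => (norm_nonneg (φ 0)).trans (hC 0)) _
  · exact (integrable_indicator_iff measurableSet_ball).2
      (integrableOn_const measure_ball_lt_top.ne)
  · have hae : ∀ᵐ a : Fin k → ℝ, F (p₀.1 * p₀.2.1) p₀.2.2 a ≠ 0 := by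
      simpa [ae_iff] using hnull (p₀.1 * p₀.2.1) p₀.2.2
    filter_upwards [hae] with a ha
    have h1 : Continuous fun p : ℝ × ℝ × ℝ => F (p.1 * p.2.1) p.2.2 a :=
      hF'.comp (by fun_prop : Continuous fun p : ℝ × ℝ × ℝ => (p, a))
    have h2 : Continuous fun p : ℝ × ℝ × ℝ => φ (Fin.cons p.2.1 (p.1 • a)) :=
      hφ'.comp (by fun_prop : Continuous fun p : ℝ × ℝ × ℝ => (p, a))
    rcases lt_or_gt_of_ne ha with h | h
    · refine (continuousAt_const (y := (0 : ℝ))).congr ?_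
      filter_upwards [h1.continuousAt.eventually_lt continuousAt_const h] with p hp
      exact (indicator_of_notMem (s := {a | 0 < F (p.1 * p.2.1) p.2.2 a}) (a := a)
        (not_lt.2 hp.le) fun a => φ (Fin.cons p.2.1 (p.1 • a))).symm
    · refine h2.continuousAt.congr ?_
      filter_upwards [continuousAt_const.eventually_lt h1.continuousAt h] with p hp
      exact (indicator_of_mem (s := {a | 0 < F (p.1 * p.2.1) p.2.2 a}) (a := a) hp
        fun a => φ (Fin.cons p.2.1 (p.1 • a))).symm

theorem measurableSet_cell {k : ℕ} {F : ℝ → ℝ → (Fin k → ℝ) → ℝ}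
    (hF : Continuous fun p : ℝ × ℝ × (Fin k → ℝ) => F p.1 p.2.1 p.2.2) (x₁ : ℝ) :
    MeasurableSet (cell k F x₁) := by
  have h : Continuous fun y : Fin (k + 1) → ℝ => F x₁ (y 0) fun i => y i.succ :=
    hF.comp (by fun_prop : Continuous fun y : Fin (k + 1) → ℝ =>
      ((x₁, y 0, fun i => y i.succ) : ℝ × ℝ × (Fin k → ℝ)))
  exact ((measurable_pi_apply 0) measurableSet_Ico).inter
    (isOpen_lt continuous_const h).measurableSet

/-- The volume of the cell is the mean of the volumes of its slices. -/
theorem volume_cell_toReal {k : ℕ} {F : ℝ → ℝ → (Fin k → ℝ) → ℝ}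
    (hF : Continuous fun p : ℝ × ℝ × (Fin k → ℝ) => F p.1 p.2.1 p.2.2) {x₁ : ℝ}
    (hfin : volume (cell k F x₁) ≠ ⊤) :
    (volume (cell k F x₁)).toReal
      = ∫ s in (0 : ℝ)..1, (volume {a : Fin k → ℝ | 0 < F x₁ s a}).toReal := by
  have hmeas := measurableSet_cell hF x₁
  have hint : Integrable ((cell k F x₁).indicator fun _ => (1 : ℝ)) :=
    (integrable_indicator_iff hmeas).2 (integrableOn_const hfin)
  have hslice : ∀ s, MeasurableSet {a : Fin k → ℝ | 0 < F x₁ s a} := fun s =>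
    (isOpen_lt continuous_const (hF.comp (by fun_prop : Continuous fun a : Fin k → ℝ =>
      ((x₁, s, a) : ℝ × ℝ × (Fin k → ℝ))))).measurableSet
  have h1 : (volume (cell k F x₁)).toReal = ∫ z, (cell k F x₁).indicator (fun _ => (1 : ℝ)) z := by
    rw [integral_indicator hmeas, setIntegral_const, smul_eq_mul, mul_one, Measure.real]
  rw [h1, integral_fin_succ_eq_integral_cons hint, intervalIntegral.integral_of_le zero_le_one,
    ← integral_Ico_eq_integral_Ioc, ← integral_indicator measurableSet_Ico]
  refine integral_congr_ae (ae_of_all _ fun s => ?_)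
  by_cases hs : s ∈ Ico (0 : ℝ) 1
  · have h2 : (fun a : Fin k → ℝ => (cell k F x₁).indicator (fun _ => (1 : ℝ)) (Fin.cons s a))
        = {a : Fin k → ℝ | 0 < F x₁ s a}.indicator fun _ => (1 : ℝ) := by
      ext a
      simp only [indicator, cell, mem_ofPred_eq, Fin.cons_zero, Fin.cons_succ, hs, true_and]
    simp only [indicator_of_mem hs]
    rw [h2, integral_indicator (hslice s), setIntegral_const, smul_eq_mul, mul_one, Measure.real]
  · have h2 : ∀ a : Fin k → ℝ,
        (cell k F x₁).indicator (fun _ => (1 : ℝ)) (Fin.cons s a) = 0 := fun a =>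
      indicator_of_notMem (fun h => hs (by simpa using h.1)) _
    simp [h2, indicator_of_notMem hs]

/-- The mean over a period of the slice integrals at scale zero. -/
theorem integral_sliceIntegral_zero {k : ℕ} {F : ℝ → ℝ → (Fin k → ℝ) → ℝ}
    (hF : Continuous fun p : ℝ × ℝ × (Fin k → ℝ) => F p.1 p.2.1 p.2.2)
    (hfin : volume (cell k F 0) ≠ ⊤) (φ : (Fin (k + 1) → ℝ) → ℝ) :
    ∫ t, ∫ s in (0 : ℝ)..1, sliceIntegral k F φ 0 t s
      = (volume (cell k F 0)).toReal * ∫ t : ℝ, φ (Fin.cons t 0) := by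
  have hslice : ∀ s, MeasurableSet {a : Fin k → ℝ | 0 < F 0 s a} := fun s =>
    (isOpen_lt continuous_const (hF.comp (by fun_prop : Continuous fun a : Fin k → ℝ =>
      ((0, s, a) : ℝ × ℝ × (Fin k → ℝ))))).measurableSet
  have h : ∀ t s, sliceIntegral k F φ 0 t s
      = (volume {a : Fin k → ℝ | 0 < F 0 s a}).toReal * φ (Fin.cons t 0) := fun t s => by
    simp only [sliceIntegral, zero_mul, zero_smul]
    rw [integral_indicator (hslice s), setIntegral_const, smul_eq_mul, Measure.real]
  simp only [h, intervalIntegral.integral_mul_const, ← volume_cell_toReal hF hfin]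
  rw [integral_const_mul]

/-- Integrals over the rescaled thin domain in terms of slice integrals. -/
theorem setIntegral_rescaled_thinDomain {k : ℕ} {F : ℝ → ℝ → (Fin k → ℝ) → ℝ}
    (hF : Continuous fun p : ℝ × ℝ × (Fin k → ℝ) => F p.1 p.2.1 p.2.2)
    {φ : (Fin (k + 1) → ℝ) → ℝ} (hφ : Continuous φ) (hφc : HasCompactSupport φ)
    {M : ℝ} (hM : ∀ z, M < |z 0| → φ z = 0) {η : ℝ} (hη : 0 < η) (hηM : η * M < 1 / 2) :
    ∫ z in {z : Fin (k + 1) → ℝ | η • z ∈ thinDomain k F (η ^ 2)}, φ z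
      = η ^ k * ∫ t, sliceIntegral k F φ η t (t / η) := by
  set S : Set (Fin (k + 1) → ℝ) := {z | 0 < F (η * z 0) (z 0 / η) (fun i => z i.succ / η)} with hS
  have hSm : MeasurableSet S := by
    have h : Continuous fun z : Fin (k + 1) → ℝ =>
        F (η * z 0) (z 0 / η) fun i => z i.succ / η :=
      hF.comp (by fun_prop : Continuous fun z : Fin (k + 1) → ℝ =>
        ((η * z 0, z 0 / η, fun i => z i.succ / η) : ℝ × ℝ × (Fin k → ℝ)))
    exact (isOpen_lt continuous_const h).measurableSet
  have hdiv : ∀ r : ℝ, η * r / η ^ 2 = r / η := fun r => by field_simp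
  have hdom : {z : Fin (k + 1) → ℝ | η • z ∈ thinDomain k F (η ^ 2)}
      = {z | η * z 0 ∈ Ioo (-(1 / 2) : ℝ) (1 / 2)} ∩ S := by
    ext z
    simp only [thinDomain, mem_ofPred_eq, mem_inter_iff, Pi.smul_apply, smul_eq_mul, hdiv, hS]
  have hIm : MeasurableSet {z : Fin (k + 1) → ℝ | η * z 0 ∈ Ioo (-(1 / 2) : ℝ) (1 / 2)} :=
    (by fun_prop : Measurable fun z : Fin (k + 1) → ℝ => η * z 0) measurableSet_Ioo
  have hind : ∫ z in {z : Fin (k + 1) → ℝ | η • z ∈ thinDomain k F (η ^ 2)}, φ z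
      = ∫ z, S.indicator φ z := by
    rw [hdom, ← integral_indicator (hIm.inter hSm)]
    refine integral_congr_ae (ae_of_all _ fun z => ?_)
    simp only [indicator, mem_inter_iff, mem_ofPred_eq]
    by_cases hz : M < |z 0|
    · simp [hM z hz]
    · have h1 : |η * z 0| < 1 / 2 := by
        rw [abs_mul, abs_of_pos hη]
        exact (mul_le_mul_of_nonneg_left (not_lt.1 hz) hη.le).trans_lt hηM
      have h2 : η * z 0 ∈ Ioo (-(1 / 2) : ℝ) (1 / 2) := abs_lt.1 h1
      simp only [h2, true_and]
  rw [hind, integral_fin_succ_eq_integral_cons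
    ((hφ.integrable_of_hasCompactSupport hφc).indicator hSm), ← integral_const_mul]
  refine integral_congr_ae (ae_of_all _ fun t => ?_)
  have hscale := Measure.integral_comp_inv_smul (volume : Measure (Fin k → ℝ))
    (fun a => {a | 0 < F (η * t) (t / η) a}.indicator (fun a => φ (Fin.cons t (η • a))) a) η
  rw [Module.finrank_fin_fun, abs_of_pos (pow_pos hη k), smul_eq_mul] at hscale
  refine Eq.trans (integral_congr_ae (ae_of_all _ fun y => ?_)) hscale
  have hsm : (fun i => y i / η) = η⁻¹ • y := by
    ext i
    simp [div_eq_inv_mul]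
  simp only [indicator, hS, mem_ofPred_eq, Fin.cons_zero, Fin.cons_succ, hsm,
    smul_inv_smul₀ hη.ne']

/-- Convergence of the rescaled measures: for every continuous compactly
supported `φ : ℝ^d → ℝ`,
`ε^{-(d-1)/2} |□(0)|⁻¹ ∫_{Ω̃_ε} φ(z) dz → ∫_ℝ φ(z₁, 0) dz₁` as `ε → 0⁺`, where
`Ω̃_ε = ε^{-1/2} Ω_ε`; i.e. the measures `dμ_ε = ε^{-(d-1)/2}|□(0)|⁻¹ χ_{Ω̃_ε} dz`
converge weak-* to `dz₁ × δ(z')`. -/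
theorem thin_domain_measures_converge (k : ℕ) (hk : 1 ≤ k)
    (F : ℝ → ℝ → (Fin k → ℝ) → ℝ)
    (hFC2 : ContDiff ℝ 2 (fun p : ℝ × ℝ × (Fin k → ℝ) => F p.1 p.2.1 p.2.2))
    (hFper : ∀ x₁ y₁ y', F x₁ (y₁ + 1) y' = F x₁ y₁ y')
    (hQne : ∀ x₁ y₁ : ℝ, ∃ y', 0 < F x₁ y₁ y')
    (R : ℝ) (hQbdd : ∀ x₁ y₁ y', 0 < F x₁ y₁ y' → ‖y'‖ < R)
    (hnull : ∀ x₁ y₁ : ℝ, volume {y' : Fin k → ℝ | F x₁ y₁ y' = 0} = 0)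
    (hcell0 : 0 < (volume (cell k F 0)).toReal) :
    ∀ φ : (Fin (k+1) → ℝ) → ℝ, Continuous φ → HasCompactSupport φ →
      Tendsto (fun ε : ℝ => ε ^ (-(k:ℝ)/2) * ((volume (cell k F 0)).toReal)⁻¹ *
          ∫ z in {z : Fin (k+1) → ℝ | Real.sqrt ε • z ∈ thinDomain k F ε}, φ z)
        (𝓝[>] 0) (𝓝 (∫ t : ℝ, φ (Fin.cons t 0))) := by
  intro φ hφ hφc
  have hF := hFC2.continuous
  have hfin : volume (cell k F 0) ≠ ⊤ := fun h => by simp [h] at hcell0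
  obtain ⟨M, hM⟩ : ∃ M : ℝ, ∀ z, M < |z 0| → φ z = 0 := by
    obtain ⟨M, hM⟩ := hφc.isCompact.isBounded.exists_norm_le
    refine ⟨M, fun z hz => ?_⟩
    by_contra hne
    exact absurd ((norm_le_pi_norm z 0).trans (hM z (subset_tsupport φ hne))) (not_le.2 hz)
  have hlim := tendsto_integral_oscillating (M := M)
    (continuous_sliceIntegral hF hQbdd hnull hφ hφc)
    (fun η t y => by simp only [sliceIntegral, hFper])
    (fun η t y ht => by
      have : ∀ a : Fin k → ℝ, φ (Fin.cons t (η • a)) = 0 := fun a => hM _ (by simpa using ht)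
      simp [sliceIntegral, this])
  rw [integral_sliceIntegral_zero hF hfin] at hlim
  have hsqrt : Tendsto Real.sqrt (𝓝[>] 0) (𝓝[>] 0) := by
    refine tendsto_nhdsWithin_iff.2 ⟨?_, ?_⟩
    · simpa using (Real.continuous_sqrt.tendsto 0).mono_left nhdsWithin_le_nhds
    · filter_upwards [self_mem_nhdsWithin] with ε hε using Real.sqrt_pos.2 hε
  have hsmall : ∀ᶠ ε : ℝ in 𝓝[>] 0, Real.sqrt ε * M < 1 / 2 := by
    have h : Tendsto (fun ε => Real.sqrt ε * M) (𝓝[>] 0) (𝓝 (0 * M)) :=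
      (hsqrt.mono_right nhdsWithin_le_nhds).mul_const M
    exact h.eventually_lt_const (by norm_num)
  have hmain := ((hlim.comp hsqrt).const_mul (volume (cell k F 0)).toReal⁻¹)
  rw [inv_mul_cancel_left₀ hcell0.ne'] at hmain
  refine hmain.congr' ?_
  filter_upwards [self_mem_nhdsWithin, hsmall] with ε (hε : 0 < ε) hεM
  have hset := setIntegral_rescaled_thinDomain hF hφ hφc hM (Real.sqrt_pos.2 hε) hεM
  rw [Real.sq_sqrt hε.le] at hset
  have hpow : ε ^ (-(k : ℝ) / 2) * Real.sqrt ε ^ k = 1 := by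
    rw [Real.sqrt_eq_rpow, ← Real.rpow_natCast, ← Real.rpow_mul hε.le, ← Real.rpow_add hε]
    ring_nf
    exact Real.rpow_zero ε
  rw [hset, Function.comp_apply]
  linear_combination (-(volume (cell k F 0)).toReal⁻¹ *
    ∫ t, sliceIntegral k F φ (Real.sqrt ε) t (t / Real.sqrt ε)) * hpow
end
end

section
/- Let □ ⊂ ℝ^d be a bounded open set with Lipschitz boundary and J ⊂ ℝ an open interval. Let A(x₁, y) be a symmetric d×d matrix function on J × □ with bounded measurable entries that are C¹ in x₁ with bounded derivative, and let ψ : J × □̄ → ℝ and μ : J → ℝ be such that: ψ(x₁, ·) is Lipschitz on □̄ and vanishes on ∂□; ∫_□ ψ(x₁, y)² dy = 1 for all x₁; the map x₁ ↦ ψ(x₁, ·) is continuously differentiable with ∂_{x₁}ψ(x₁, ·) Lipschitz on □̄ and vanishing on ∂□, and ψ, ∇_yψ, ∂_{x₁}ψ, ∇_y∂_{x₁}ψ are bounded and continuous in (x₁, y), so that all the integrals below may be differentiated in x₁ under the integral sign; the weak eigenvalue identity ∫_□ A(x₁, y)∇_yψ(x₁, y)·∇_yφ(y) dy = μ(x₁)∫_□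 ψ(x₁, y)φ(y) dy holds for every Lipschitz φ on □̄ vanishing on ∂□. Then μ is differentiable and μ'(x₁) = ∫_□ ∂_{x₁}A(x₁, y)∇_yψ(x₁, y)·∇_yψ(x₁, y) dy for every x₁ ∈ J. -/
open MeasureTheory Set

open Filter Topology

/-- Entrywise bounds on a matrix and norm bounds on two covectors bound the associated bilinear
expression. -/
lemma norm_sum_mul_apply_single_le {d : ℕ} (B : Fin d → Fin d → ℝ) (f g : (Fin d → ℝ) →L[ℝ] ℝ)
    {M N : ℝ} (hB : ∀ i j, |B i j| ≤ M) (hf : ‖f‖ ≤ N) (hg : ‖g‖ ≤ N) :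
    ‖∑ i, ∑ j, B i j * f (Pi.single j 1) * g (Pi.single i 1)‖
      ≤ ∑ _i : Fin d, ∑ _j : Fin d, M * N * N := by
  have key : ∀ h : (Fin d → ℝ) →L[ℝ] ℝ, ‖h‖ ≤ N → ∀ i, |h (Pi.single i 1)| ≤ N := by
    intro h hh i
    have h1 := h.le_opNorm (Pi.single i 1)
    rw [Pi.norm_single, norm_one, mul_one] at h1
    exact h1.trans hh
  have hN : 0 ≤ N := (norm_nonneg f).trans hf
  refine (norm_sum_le _ _).trans (Finset.sum_le_sum fun i _ => ?_)
  refine (norm_sum_le _ _).trans (Finset.sum_le_sum fun j _ => ?_)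
  have hM : 0 ≤ M := (abs_nonneg _).trans (hB i j)
  rw [norm_mul, norm_mul]
  exact mul_le_mul (mul_le_mul (hB i j) (key f hf j) (abs_nonneg _) hM) (key g hg i)
    (abs_nonneg _) (mul_nonneg hM hN)

/-- A bilinear expression in two gradients with measurable coefficients is measurable. -/
lemma measurable_sum_mul_fderiv_single {d : ℕ} {B : (Fin d → ℝ) → Fin d → Fin d → ℝ}
    (hB : ∀ i j, Measurable fun y => B y i j) (u v : (Fin d → ℝ) → ℝ) :
    Measurable fun y => ∑ i, ∑ j,
      B y i j * fderiv ℝ u y (Pi.single j 1) * fderiv ℝ v y (Pi.single i 1) :=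
  Finset.measurable_fun_sum _ fun i _ => Finset.measurable_fun_sum _ fun j _ =>
    ((hB i j).mul (measurable_fderiv_apply_const ℝ u _)).mul (measurable_fderiv_apply_const ℝ v _)

/-- A function with derivative bounded by `M` on an open interval has difference quotients
bounded by `M`. -/
lemma abs_sub_div_sub_le_of_hasDerivAt {a b M : ℝ} {f f' : ℝ → ℝ}
    (hf : ∀ t ∈ Ioo a b, HasDerivAt f (f' t) t) (hM : ∀ t ∈ Ioo a b, |f' t| ≤ M)
    {s t : ℝ} (hs : s ∈ Ioo a b) (ht : t ∈ Ioo a b) : |(f t - f s) / (t - s)| ≤ M := by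
  have h := (convex_Ioo a b).norm_image_sub_le_of_norm_hasDerivWithin_le
    (fun x hx => (hf x hx).hasDerivWithinAt) hM hs ht
  rw [abs_div]
  exact div_le_of_le_mul₀ (abs_nonneg _) ((abs_nonneg _).trans (hM s hs)) h

/-- Derivative of the principal eigenvalue of the cell problem with a fixed
cell: if `(μ(x₁), ψ(x₁,·))` satisfies the weak eigenvalue identity
`∫ A(x₁,·)∇ψ·∇φ = μ(x₁) ∫ ψ φ` with normalization `∫ ψ² = 1`, and everything is regular
enough to differentiate under the integral sign, then
`μ'(x₁) = ∫ (∂_{x₁}A) ∇ψ·∇ψ`. -/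
theorem eigenvalue_derivative_fixed_cell (d : ℕ)
    (Box : Set (Fin d → ℝ)) (hBox : IsOpen Box) (hBdd : Bornology.IsBounded Box)
    (J : Set ℝ) (hJ : ∃ a b : ℝ, J = Ioo a b)
    (A A' : ℝ → (Fin d → ℝ) → Fin d → Fin d → ℝ)
    (hAsym : ∀ x₁ y i j, A x₁ y i j = A x₁ y j i)
    (hAmeas : ∀ x₁, Measurable (A x₁))
    (MA : ℝ) (hAbdd : ∀ x₁ ∈ J, ∀ y i j, |A x₁ y i j| ≤ MA ∧ |A' x₁ y i j| ≤ MA)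
    (hA' : ∀ x₁ ∈ J, ∀ y i j, HasDerivAt (fun t => A t y i j) (A' x₁ y i j) x₁)
    (hA'cont : ∀ y i j, ContinuousOn (fun t => A' t y i j) J)
    (ψ ψ' : ℝ → (Fin d → ℝ) → ℝ) (μ : ℝ → ℝ)
    (L : NNReal)
    (hψlip : ∀ x₁ ∈ J, LipschitzOnWith L (ψ x₁) (closure Box))
    (hψbd : ∀ x₁ ∈ J, ∀ y ∈ frontier Box, ψ x₁ y = 0)
    (hnorm : ∀ x₁ ∈ J, ∫ y in Box, ψ x₁ y ^ 2 = 1)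
    (hψ' : ∀ x₁ ∈ J, ∀ y, HasDerivAt (fun t => ψ t y) (ψ' x₁ y) x₁)
    (hψ'lip : ∀ x₁ ∈ J, LipschitzOnWith L (ψ' x₁) (closure Box))
    (hψ'bd : ∀ x₁ ∈ J, ∀ y ∈ frontier Box, ψ' x₁ y = 0)
    (hdiff : ∀ x₁ ∈ J, ∀ y ∈ Box,
      DifferentiableAt ℝ (ψ x₁) y ∧ DifferentiableAt ℝ (ψ' x₁) y)
    (Mψ : ℝ)
    (hbnd : ∀ x₁ ∈ J, ∀ y ∈ Box, |ψ x₁ y| ≤ Mψ ∧ ‖fderiv ℝ (ψ x₁) y‖ ≤ Mψ ∧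
      |ψ' x₁ y| ≤ Mψ ∧ ‖fderiv ℝ (ψ' x₁) y‖ ≤ Mψ)
    (hcψ : ContinuousOn (fun p : ℝ × (Fin d → ℝ) => ψ p.1 p.2) (J ×ˢ Box))
    (hcψ' : ContinuousOn (fun p : ℝ × (Fin d → ℝ) => ψ' p.1 p.2) (J ×ˢ Box))
    (hcgradpsi : ContinuousOn (fun p : ℝ × (Fin d → ℝ) => fderiv ℝ (ψ p.1) p.2) (J ×ˢ Box))
    (hcgradpsi' : ContinuousOn (fun p : ℝ × (Fin d → ℝ) => fderiv ℝ (ψ' p.1) p.2) (J ×ˢ Box))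
    (hweak : ∀ x₁ ∈ J, ∀ φ : (Fin d → ℝ) → ℝ,
      (∃ Lφ : NNReal, LipschitzOnWith Lφ φ (closure Box)) →
      (∀ y ∈ frontier Box, φ y = 0) →
      ∫ y in Box, ∑ i, ∑ j, A x₁ y i j *
          fderiv ℝ (ψ x₁) y (Pi.single j 1) * fderiv ℝ φ y (Pi.single i 1)
        = μ x₁ * ∫ y in Box, ψ x₁ y * φ y) :
    ∀ x₁ ∈ J, HasDerivAt μ
      (∫ y in Box, ∑ i, ∑ j, A' x₁ y i j *
        fderiv ℝ (ψ x₁) y (Pi.single j 1) * fderiv ℝ (ψ x₁) y (Pi.single i 1)) x₁ := by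
  obtain ⟨a, b, rfl⟩ := hJ
  intro s hs
  have hAm : ∀ t i j, Measurable fun y => A t y i j := fun t i j =>
    (measurable_pi_apply j).comp ((measurable_pi_apply i).comp (hAmeas t))
  have hfin : IsFiniteMeasure (volume.restrict Box) :=
    isFiniteMeasure_restrict.2 hBdd.measure_lt_top.ne
  have hJnhds : ∀ᶠ t in 𝓝 s, t ∈ Ioo a b := isOpen_Ioo.mem_nhds hs
  have hJne : ∀ᶠ t in 𝓝[≠] s, t ∈ Ioo a b := hJnhds.filter_mono nhdsWithin_le_nhds
  have slice : ∀ {E : Type} [TopologicalSpace E] (F : ℝ → (Fin d → ℝ) → E),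
      ContinuousOn (fun p : ℝ × (Fin d → ℝ) => F p.1 p.2) (Ioo a b ×ˢ Box) →
      ∀ y ∈ Box, Tendsto (fun t => F t y) (𝓝[≠] s) (𝓝 (F s y)) := by
    intro E _ F hF y hy
    have h1 : ContinuousAt (fun p : ℝ × (Fin d → ℝ) => F p.1 p.2) (s, y) :=
      hF.continuousAt ((isOpen_Ioo.prod hBox).mem_nhds ⟨hs, hy⟩)
    have h2 : ContinuousAt (fun t : ℝ => (t, y)) s := by fun_prop
    exact (ContinuousAt.comp (f := fun t : ℝ => (t, y)) h1 h2).mono_left nhdsWithin_le_nhds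
  have hψm : ∀ t ∈ Ioo a b, AEStronglyMeasurable (ψ t) (volume.restrict Box) := fun t ht =>
    ((hψlip t ht).continuousOn.mono subset_closure).aestronglyMeasurable hBox.measurableSet
  set c : ℝ → ℝ := fun t => ∫ y in Box, ψ s y * ψ t y with hc
  set I : ℝ → ℝ := fun t => ∫ y in Box, ∑ i, ∑ j, (A t y i j - A s y i j) / (t - s) *
    fderiv ℝ (ψ s) y (Pi.single j 1) * fderiv ℝ (ψ t) y (Pi.single i 1) with hI
  have hclim : Tendsto c (𝓝[≠] s) (𝓝 1) := by
    have hcs : ∫ y in Box, ψ s y * ψ s y = 1 := by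
      simpa only [sq] using hnorm s hs
    rw [← hcs]
    refine tendsto_integral_filter_of_dominated_convergence (fun _ => Mψ * Mψ) ?_ ?_
      (integrable_const _) ?_
    · filter_upwards [hJne] with t ht using (hψm s hs).mul (hψm t ht)
    · filter_upwards [hJne] with t ht
      filter_upwards [ae_restrict_mem hBox.measurableSet] with y hy
      rw [norm_mul]
      have h1 := (hbnd s hs y hy).1
      exact mul_le_mul h1 (hbnd t ht y hy).1 (abs_nonneg _) ((abs_nonneg _).trans h1)
    · filter_upwards [ae_restrict_mem hBox.measurableSet] with y hy
      exact (slice ψ hcψ y hy).const_mul _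
  have hIlim : Tendsto I (𝓝[≠] s) (𝓝 (∫ y in Box, ∑ i, ∑ j, A' s y i j *
      fderiv ℝ (ψ s) y (Pi.single j 1) * fderiv ℝ (ψ s) y (Pi.single i 1))) := by
    refine tendsto_integral_filter_of_dominated_convergence
      (fun _ => ∑ _i : Fin d, ∑ _j : Fin d, MA * Mψ * Mψ) ?_ ?_ (integrable_const _) ?_
    · refine Eventually.of_forall fun t => Measurable.aestronglyMeasurable ?_
      exact measurable_sum_mul_fderiv_single
        (B := fun y i j => (A t y i j - A s y i j) / (t - s))
        (fun i j => ((hAm t i j).sub (hAm s i j)).div_const _) _ _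
    · filter_upwards [hJne] with t ht
      filter_upwards [ae_restrict_mem hBox.measurableSet] with y hy
      exact norm_sum_mul_apply_single_le (fun i j => (A t y i j - A s y i j) / (t - s)) _ _
        (fun i j => abs_sub_div_sub_le_of_hasDerivAt (fun r hr => hA' r hr y i j)
          (fun r hr => (hAbdd r hr y i j).2) hs ht)
        (hbnd s hs y hy).2.1 (hbnd t ht y hy).2.1
    · filter_upwards [ae_restrict_mem hBox.measurableSet] with y hy
      refine tendsto_finsetSum _ fun i _ => tendsto_finsetSum _ fun j _ => ?_
      refine Tendsto.mul (Tendsto.mul_const _ ?_) ?_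
      · have h := hasDerivAt_iff_tendsto_slope.1 (hA' s hs y i j)
        simpa only [slope_fun_def_field] using h
      · exact ((ContinuousLinearMap.apply ℝ ℝ (Pi.single i (1 : ℝ))).continuous.tendsto _).comp
          (slice (fun t y => fderiv ℝ (ψ t) y) hcgradpsi y hy)
  have hint : ∀ r ∈ Ioo a b, ∀ p ∈ Ioo a b, ∀ q ∈ Ioo a b, IntegrableOn (fun y => ∑ i, ∑ j,
      A r y i j * fderiv ℝ (ψ p) y (Pi.single j 1) * fderiv ℝ (ψ q) y (Pi.single i 1)) Box := by
    intro r hr p hp q hq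
    refine Integrable.of_bound
      (measurable_sum_mul_fderiv_single (hAm r) _ _).aestronglyMeasurable
      (∑ _i : Fin d, ∑ _j : Fin d, MA * Mψ * Mψ) ?_
    filter_upwards [ae_restrict_mem hBox.measurableSet] with y hy
    exact norm_sum_mul_apply_single_le (A r y) _ _ (fun i j => (hAbdd r hr y i j).1)
      (hbnd p hp y hy).2.1 (hbnd q hq y hy).2.1
  have hid : ∀ t ∈ Ioo a b, t ≠ s → (μ t - μ s) * c t = (t - s) * I t := by
    intro t ht hts
    have hts' : t - s ≠ 0 := sub_ne_zero.2 hts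
    have h1 := hweak s hs (ψ t) ⟨L, hψlip t ht⟩ (hψbd t ht)
    have h2 := hweak t ht (ψ s) ⟨L, hψlip s hs⟩ (hψbd s hs)
    have h3 : ∫ y in Box, ψ t y * ψ s y = c t := by simp only [hc, mul_comm]
    have h4 : ∀ y, ∑ i, ∑ j, A t y i j * fderiv ℝ (ψ t) y (Pi.single j 1) *
          fderiv ℝ (ψ s) y (Pi.single i 1)
        = ∑ i, ∑ j, A t y i j * fderiv ℝ (ψ s) y (Pi.single j 1) *
          fderiv ℝ (ψ t) y (Pi.single i 1) := by
      intro y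
      rw [Finset.sum_comm]
      refine Finset.sum_congr rfl fun i _ => Finset.sum_congr rfl fun j _ => ?_
      rw [hAsym t y j i]
      ring
    simp only [h4] at h2
    rw [h3] at h2
    rw [sub_mul, ← h2, ← h1, ← integral_sub (hint t ht s hs t ht) (hint s hs s hs t ht), hI,
      ← integral_const_mul]
    refine integral_congr_ae (Eventually.of_forall fun y => ?_)
    simp only [Finset.mul_sum, ← Finset.sum_sub_distrib]
    refine Finset.sum_congr rfl fun i _ => Finset.sum_congr rfl fun j _ => ?_
    field_simp
  rw [hasDerivAt_iff_tendsto_slope]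
  have hquot := hIlim.div hclim one_ne_zero
  rw [div_one] at hquot
  refine hquot.congr' ?_
  filter_upwards [hJne, self_mem_nhdsWithin, hclim.eventually_ne one_ne_zero] with t ht hts hct
  have hts' : t - s ≠ 0 := sub_ne_zero.2 hts
  rw [slope_def_field, Pi.div_apply, div_eq_div_iff hct hts', hid t ht hts, mul_comm]
end

section
/- Under the weighted corrector hypotheses, for all i, j ∈ {1, …, d} one has a^eff_{ij} = ∫_C ψ(y)² A(y)∇(y_i + N_i(y)) · ∇(y_j + N_j(y)) dy, where a^eff_{ij} := ∫_C Σ_{k=1}^d ψ(y)² a_{ik}(y)(δ_{kj} + ∂_{y_k}N_j(y)) dy. In particular the matrix (a^eff_{ij}) is symmetric and positive semidefinite. -/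
open MeasureTheory Set

noncomputable section

/-- The effective coefficient `a^eff_{ij} = ∫_C Σ_k ψ² a_{ik} (δ_{kj} + ∂_{y_k} N_j) dy`. -/
def aeff (d : ℕ) (ψ : (Fin d → ℝ) → ℝ) (A : (Fin d → ℝ) → Fin d → Fin d → ℝ)
    (N : Fin d → (Fin d → ℝ) → ℝ) (C : Set (Fin d → ℝ)) (i j : Fin d) : ℝ :=
  ∫ y in C, ∑ k, ψ y ^ 2 * A y i k *
    ((if k = j then (1:ℝ) else 0) + fderiv ℝ (N j) y (Pi.single k 1))

/-- A weighted Cauchy–Schwarz integrability criterion. -/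
theorem integrable_weight_mul_mul {X : Type*} [MeasurableSpace X] {μ : Measure X}
    {w a f g : X → ℝ} {M : ℝ} (hw : Measurable w) (ha : Measurable a) (hf : Measurable f)
    (hg : Measurable g) (hw0 : ∀ x, 0 ≤ w x) (haM : ∀ x, |a x| ≤ M)
    (hfi : Integrable (fun x => w x * f x ^ 2) μ) (hgi : Integrable (fun x => w x * g x ^ 2) μ) :
    Integrable (fun x => w x * (a x * f x * g x)) μ := by
  refine ((hfi.add hgi).const_mul M).mono'
    (hw.mul ((ha.mul hf).mul hg)).aestronglyMeasurable (.of_forall fun x => ?_)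
  have hM : 0 ≤ M := (abs_nonneg _).trans (haM x)
  have hfg : |f x| * |g x| ≤ f x ^ 2 + g x ^ 2 := by
    nlinarith [sq_nonneg (|f x| - |g x|), sq_abs (f x), sq_abs (g x), sq_nonneg (f x),
      sq_nonneg (g x)]
  have hafg : |a x| * (|f x| * |g x|) ≤ M * (f x ^ 2 + g x ^ 2) :=
    mul_le_mul (haM x) hfg (by positivity) hM
  simp only [Real.norm_eq_abs, abs_mul, abs_of_nonneg (hw0 x), Pi.add_apply]
  nlinarith [mul_le_mul_of_nonneg_left hafg (hw0 x)]

/-- Weighted bilinear forms with bounded coefficients are integrable on weighted `L²` fields. -/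
theorem integrable_weight_bilin {X ι : Type*} [Fintype ι] [MeasurableSpace X] {μ : Measure X}
    {w : X → ℝ} {A : X → ι → ι → ℝ} {f g : ι → X → ℝ} {M : ℝ} (hw : Measurable w)
    (hA : Measurable A) (hf : ∀ p, Measurable (f p)) (hg : ∀ p, Measurable (g p))
    (hw0 : ∀ x, 0 ≤ w x) (hAM : ∀ x p q, |A x p q| ≤ M)
    (hfi : ∀ p, Integrable (fun x => w x * f p x ^ 2) μ)
    (hgi : ∀ p, Integrable (fun x => w x * g p x ^ 2) μ) :
    Integrable (fun x => w x * ∑ p, ∑ q, A x p q * f q x * g p x) μ := by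
  simp only [Finset.mul_sum]
  refine integrable_finsetSum _ fun p _ => integrable_finsetSum _ fun q _ => ?_
  exact integrable_weight_mul_mul hw ((measurable_pi_apply q).comp ((measurable_pi_apply p).comp hA))
    (hf q) (hg p) hw0 (fun x => hAM x p q) (hfi q) (hgi p)

/-- Under the weighted corrector hypotheses,
`a^eff_{ij} = ∫_C ψ² A ∇(y_i + N_i)·∇(y_j + N_j) dy`; in particular `(a^eff_{ij})`
is symmetric and positive semidefinite. -/
theorem aeff_symmetric_form (d : ℕ) [NeZero d] (α : ℝ) (hα : 0 < α)
    (Box : Set (Fin d → ℝ)) (hBox : IsOpen Box)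
    (hBoxper : ∀ y, y ∈ Box ↔ y + Pi.single (0 : Fin d) (1:ℝ) ∈ Box)
    (C : Set (Fin d → ℝ)) (hC : C = Box ∩ {y | y 0 ∈ Ico (0:ℝ) 1})
    (hCbdd : Bornology.IsBounded C)
    (ψ : (Fin d → ℝ) → ℝ) (hψcont : Continuous ψ)
    (hψper : ∀ y, ψ (y + Pi.single (0 : Fin d) (1:ℝ)) = ψ y)
    (hψpos : ∀ y ∈ Box, 0 < ψ y) (hψzero : ∀ y ∉ Box, ψ y = 0)
    (A : (Fin d → ℝ) → Fin d → Fin d → ℝ)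
    (hAper : ∀ y i j, A (y + Pi.single (0 : Fin d) (1:ℝ)) i j = A y i j)
    (hAsym : ∀ y i j, A y i j = A y j i)
    (hAmeas : Measurable A) (M : ℝ) (hAbdd : ∀ y i j, |A y i j| ≤ M)
    (hell : ∀ y (ξ : Fin d → ℝ), α * ∑ i, ξ i ^ 2 ≤ ∑ i, ∑ j, A y i j * ξ i * ξ j)
    (N : Fin d → (Fin d → ℝ) → ℝ)
    (hNC1 : ∀ k, ContDiffOn ℝ 1 (N k) Box)
    (hNper : ∀ k y, N k (y + Pi.single (0 : Fin d) (1:ℝ)) = N k y)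
    (hNint : ∀ k, IntegrableOn
      (fun y => ψ y ^ 2 * ((N k y) ^ 2 + ∑ j, fderiv ℝ (N k) y (Pi.single j 1) ^ 2)) C)
    (hNweak : ∀ k, ∀ φ : (Fin d → ℝ) → ℝ, ContDiffOn ℝ 1 φ Box →
      (∀ y, φ (y + Pi.single (0 : Fin d) (1:ℝ)) = φ y) →
      IntegrableOn (fun y => ψ y ^ 2 * ((φ y) ^ 2 + ∑ j, fderiv ℝ φ y (Pi.single j 1) ^ 2)) C →
      ∫ y in C, ψ y ^ 2 * ∑ i, ∑ j, A y i j *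
          fderiv ℝ (N k) y (Pi.single j 1) * fderiv ℝ φ y (Pi.single i 1)
        = -∫ y in C, ∑ j, ψ y ^ 2 * A y k j * fderiv ℝ φ y (Pi.single j 1)) :
    (∀ i j, aeff d ψ A N C i j =
      ∫ y in C, ψ y ^ 2 * ∑ p, ∑ q, A y p q *
        ((if q = i then (1:ℝ) else 0) + fderiv ℝ (N i) y (Pi.single q 1)) *
        ((if p = j then (1:ℝ) else 0) + fderiv ℝ (N j) y (Pi.single p 1))) ∧
    (∀ i j, aeff d ψ A N C i j = aeff d ψ A N C j i) ∧
    (∀ ξ : Fin d → ℝ, 0 ≤ ∑ i, ∑ j, aeff d ψ A N C i j * ξ i * ξ j) := by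
  have hwcont : Continuous fun y => ψ y ^ 2 := hψcont.pow 2
  have hw := hwcont.measurable
  have hw0 : ∀ y, 0 ≤ ψ y ^ 2 := fun y => sq_nonneg _
  have hwint : IntegrableOn (fun y => ψ y ^ 2) C :=
    (hwcont.continuousOn.integrableOn_compact hCbdd.isCompact_closure).mono_set subset_closure
  let e : Fin d → Fin d → (Fin d → ℝ) → ℝ := fun k q _ => if q = k then 1 else 0
  let G : Fin d → Fin d → (Fin d → ℝ) → ℝ := fun k q y => fderiv ℝ (N k) y (Pi.single q 1)
  let V : Fin d → Fin d → (Fin d → ℝ) → ℝ := fun k q y => e k q y + G k q y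
  let B : (Fin d → (Fin d → ℝ) → ℝ) → (Fin d → (Fin d → ℝ) → ℝ) → (Fin d → ℝ) → ℝ :=
    fun f g y => ψ y ^ 2 * ∑ p, ∑ q, A y p q * f q y * g p y
  have hem : ∀ k q, Measurable (e k q) := fun k q => measurable_const
  have hGm : ∀ k q, Measurable (G k q) := fun k q => measurable_fderiv_apply_const ℝ (N k) _
  have hei : ∀ k q, IntegrableOn (fun y => ψ y ^ 2 * e k q y ^ 2) C :=
    fun k q => hwint.mul_const ((if q = k then (1 : ℝ) else 0) ^ 2)
  have hGi : ∀ k q, IntegrableOn (fun y => ψ y ^ 2 * G k q y ^ 2) C := by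
    intro k q
    refine (hNint k).mono' (hw.mul ((hGm k q).pow_const 2)).aestronglyMeasurable
      (.of_forall fun y => ?_)
    rw [Real.norm_of_nonneg (by positivity)]
    refine mul_le_mul_of_nonneg_left ?_ (hw0 y)
    have := Finset.single_le_sum (f := fun q => G k q y ^ 2) (fun q _ => sq_nonneg _)
      (Finset.mem_univ q)
    exact this.trans (le_add_of_nonneg_left (sq_nonneg _))
  have hee : ∀ i j, IntegrableOn (B (e i) (e j)) C := fun i j =>
    integrable_weight_bilin hw hAmeas (hem i) (hem j) hw0 hAbdd (hei i) (hei j)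
  have heG : ∀ i j, IntegrableOn (B (e i) (G j)) C := fun i j =>
    integrable_weight_bilin hw hAmeas (hem i) (hGm j) hw0 hAbdd (hei i) (hGi j)
  have hGe : ∀ i j, IntegrableOn (B (G i) (e j)) C := fun i j =>
    integrable_weight_bilin hw hAmeas (hGm i) (hem j) hw0 hAbdd (hGi i) (hei j)
  have hGG : ∀ i j, IntegrableOn (B (G i) (G j)) C := fun i j =>
    integrable_weight_bilin hw hAmeas (hGm i) (hGm j) hw0 hAbdd (hGi i) (hGi j)
  have hBsymm : ∀ f g, B f g = B g f := by
    intro f g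
    funext y
    simp only [B]
    rw [Finset.sum_comm]
    congr 1
    refine Finset.sum_congr rfl fun p _ => Finset.sum_congr rfl fun q _ => ?_
    rw [hAsym y q p]
    ring
  have hBe : ∀ i f y, B (e i) f y = ∑ p, ψ y ^ 2 * A y i p * f p y := by
    intro i f y
    simp only [B, e, mul_ite, ite_mul, one_mul, mul_zero, zero_mul, Finset.sum_ite_eq',
      Finset.mem_univ, if_true, Finset.mul_sum, hAsym y i, mul_assoc]
  have hBV : ∀ i j, B (V i) (V j) =
      (B (e i) (e j) + B (e i) (G j)) + (B (G i) (e j) + B (G i) (G j)) := by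
    intro i j
    funext y
    simp only [B, V, Pi.add_apply, ← mul_add, ← Finset.sum_add_distrib]
    congr 1
    refine Finset.sum_congr rfl fun p _ => Finset.sum_congr rfl fun q _ => ?_
    ring
  have hVV : ∀ i j, IntegrableOn (B (V i) (V j)) C := fun i j => by
    rw [hBV]
    exact ((hee i j).add (heG i j)).add ((hGe i j).add (hGG i j))
  have haeff : ∀ i j, aeff d ψ A N C i j = ∫ y in C, (B (e i) (e j) + B (e i) (G j)) y := by
    intro i j
    refine integral_congr_ae (.of_forall fun y => ?_)
    simp only [Pi.add_apply, hBe, ← Finset.sum_add_distrib, ← mul_add, e, G]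
  have hweak : ∀ i j, ∫ y in C, (B (G i) (e j) + B (G i) (G j)) y = 0 := by
    intro i j
    have h := hNweak j (N i) (hNC1 i) (hNper i) (hNint i)
    have h1 : ∫ y in C, B (G i) (G j) y = -∫ y in C, B (G i) (e j) y := by
      rw [hBsymm (G i) (G j)]
      refine h.trans (congrArg Neg.neg (integral_congr_ae (.of_forall fun y => ?_)))
      rw [hBsymm, hBe]
    have h2 := integral_add (hGe i j) (hGG i j)
    simp only [Pi.add_apply] at h2 ⊢
    rw [h2, h1, add_neg_cancel]
  have hform : ∀ i j, aeff d ψ A N C i j = ∫ y in C, B (V i) (V j) y := by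
    intro i j
    have h := integral_add ((hee i j).add (heG i j)) ((hGe i j).add (hGG i j))
    rw [hweak, add_zero] at h
    rw [haeff, hBV]
    exact h.symm
  refine ⟨hform, fun i j => ?_, fun ξ => ?_⟩
  · rw [hform, hform, hBsymm]
  · have hsum : ∑ i, ∑ j, aeff d ψ A N C i j * ξ i * ξ j
        = ∫ y in C, ∑ i, ∑ j, B (V i) (V j) y * ξ i * ξ j := by
      have hint : ∀ i j, IntegrableOn (fun y => B (V i) (V j) y * ξ i * ξ j) C :=
        fun i j => ((hVV i j).mul_const _).mul_const _
      rw [integral_finsetSum _ fun i _ => integrable_finsetSum _ fun j _ => hint i j]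
      refine Finset.sum_congr rfl fun i _ => ?_
      rw [integral_finsetSum _ fun j _ => hint i j]
      refine Finset.sum_congr rfl fun j _ => ?_
      rw [integral_mul_const, integral_mul_const, hform]
    rw [hsum]
    refine integral_nonneg fun y => ?_
    have hquad : ∑ i, ∑ j, B (V i) (V j) y * ξ i * ξ j =
        ψ y ^ 2 * ∑ p, ∑ q, A y p q * (∑ j, ξ j * V j p y) * (∑ i, ξ i * V i q y) := by
      simp only [B, Finset.mul_sum, Finset.sum_mul]
      have hcomm : ∀ F : Fin d → Fin d → Fin d → Fin d → ℝ,
          ∑ i, ∑ j, ∑ p, ∑ q, F i j p q = ∑ p, ∑ q, ∑ i, ∑ j, F i j p q := by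
        intro F
        simpa only [Fintype.sum_prod_type] using Finset.sum_comm (s := Finset.univ)
          (t := Finset.univ) (f := fun a b : Fin d × Fin d => F a.1 a.2 b.1 b.2)
      rw [hcomm]
      refine Finset.sum_congr rfl fun p _ => Finset.sum_congr rfl fun q _ =>
        Finset.sum_congr rfl fun i _ => Finset.sum_congr rfl fun j _ => ?_
      ring
    change 0 ≤ ∑ i, ∑ j, B (V i) (V j) y * ξ i * ξ j
    rw [hquad]
    refine mul_nonneg (hw0 y) (le_trans ?_ (hell y fun p => ∑ j, ξ j * V j p y))
    positivity
end
end

section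
/- Under the weighted corrector hypotheses, the transverse entries of the effective matrix vanish: a^eff_{ij} = 0 for every pair (i, j) ≠ (1, 1), where a^eff_{ij} := ∫_C Σ_{k=1}^d ψ(y)² a_{ik}(y)(δ_{kj} + ∂_{y_k}N_j(y)) dy. -/
open MeasureTheory Set

noncomputable section

/-- A continuous function is integrable on a bounded set. -/
lemma Continuous.integrableOn_of_isBounded {d : ℕ} {f : (Fin d → ℝ) → ℝ} (hf : Continuous f)
    {C : Set (Fin d → ℝ)} (hC : Bornology.IsBounded C) : IntegrableOn f C :=
  (hf.continuousOn.integrableOn_compact hC.isCompact_closure).mono_set subset_closure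

/-- A bounded coefficient times a partial derivative with finite weighted energy is integrable
against the weight. -/
lemma integrableOn_weight_mul_fderiv {d : ℕ} {C : Set (Fin d → ℝ)}
    (hC : Bornology.IsBounded C) {ψ : (Fin d → ℝ) → ℝ} (hψ : Continuous ψ)
    {a : (Fin d → ℝ) → ℝ} (ha : Measurable a) {M : ℝ} (haM : ∀ y, |a y| ≤ M)
    {N : (Fin d → ℝ) → ℝ}
    (hN : IntegrableOn
      (fun y => ψ y ^ 2 * ((N y) ^ 2 + ∑ j, fderiv ℝ N y (Pi.single j 1) ^ 2)) C) (k : Fin d) :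
    IntegrableOn (fun y => ψ y ^ 2 * a y * fderiv ℝ N y (Pi.single k 1)) C := by
  have hmeas : Measurable fun y => ψ y ^ 2 * a y * fderiv ℝ N y (Pi.single k 1) :=
    ((hψ.measurable.pow_const 2).mul ha).mul (measurable_fderiv_apply_const ℝ N _)
  refine Integrable.mono'
    ((((hψ.pow 2).integrableOn_of_isBounded hC).add hN).const_mul M)
    hmeas.aestronglyMeasurable (Filter.Eventually.of_forall fun y => ?_)
  have hk : fderiv ℝ N y (Pi.single k 1) ^ 2 ≤ ∑ j, fderiv ℝ N y (Pi.single j 1) ^ 2 :=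
    Finset.single_le_sum (f := fun j => fderiv ℝ N y (Pi.single j 1) ^ 2)
      (fun j _ => sq_nonneg _) (Finset.mem_univ k)
  have hM : 0 ≤ M := (abs_nonneg _).trans (haM y)
  set g := fderiv ℝ N y (Pi.single k 1)
  have hg : |g| ≤ 1 + (N y ^ 2 + ∑ j, fderiv ℝ N y (Pi.single j 1) ^ 2) := by
    nlinarith [sq_abs g, sq_nonneg (|g| - 1), sq_nonneg (N y)]
  calc ‖ψ y ^ 2 * a y * g‖ = |a y| * (ψ y ^ 2 * |g|) := by
        rw [Real.norm_eq_abs, abs_mul, abs_mul, abs_of_nonneg (sq_nonneg (ψ y))]; ring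
    _ ≤ M * (ψ y ^ 2 * (1 + (N y ^ 2 + ∑ j, fderiv ℝ N y (Pi.single j 1) ^ 2))) := by
        gcongr
        exact haM y
    _ = M * (ψ y ^ 2 + ψ y ^ 2 * (N y ^ 2 + ∑ j, fderiv ℝ N y (Pi.single j 1) ^ 2)) := by
        ring

/-- A bounded coefficient is integrable against a continuous weight on a bounded set. -/
lemma integrableOn_weight_mul {d : ℕ} {C : Set (Fin d → ℝ)}
    (hC : Bornology.IsBounded C) {ψ : (Fin d → ℝ) → ℝ} (hψ : Continuous ψ)
    {a : (Fin d → ℝ) → ℝ} (ha : Measurable a) {M : ℝ} (haM : ∀ y, |a y| ≤ M) :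
    IntegrableOn (fun y => ψ y ^ 2 * a y) C :=
  ((hψ.pow 2).integrableOn_of_isBounded hC).mul_bdd (c := M) ha.aestronglyMeasurable
    (Filter.Eventually.of_forall haM)

/-- The effective coefficient splits into the averaged coefficient and the corrector flux. -/
lemma aeff_eq_add {d : ℕ} {C : Set (Fin d → ℝ)}
    (hC : Bornology.IsBounded C) {ψ : (Fin d → ℝ) → ℝ} (hψ : Continuous ψ)
    {A : (Fin d → ℝ) → Fin d → Fin d → ℝ} (hA : Measurable A)
    {M : ℝ} (hAM : ∀ y i j, |A y i j| ≤ M) {N : Fin d → (Fin d → ℝ) → ℝ}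
    (hN : ∀ k, IntegrableOn
      (fun y => ψ y ^ 2 * ((N k y) ^ 2 + ∑ j, fderiv ℝ (N k) y (Pi.single j 1) ^ 2)) C)
    (i j : Fin d) :
    aeff d ψ A N C i j = (∫ y in C, ψ y ^ 2 * A y i j) +
      ∫ y in C, ∑ k, ψ y ^ 2 * A y i k * fderiv ℝ (N j) y (Pi.single k 1) := by
  have hm : ∀ i k, Measurable fun y => A y i k := fun i k =>
    (measurable_pi_apply k).comp ((measurable_pi_apply i).comp hA)
  rw [← integral_add (integrableOn_weight_mul hC hψ (hm i j) fun y => hAM y i j)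
    (integrable_finsetSum _ fun k _ =>
      integrableOn_weight_mul_fderiv hC hψ (hm i k) (fun y => hAM y i k) (hN j) k)]
  simp [aeff, mul_add, Finset.sum_add_distrib]

/-- Under the weighted corrector hypotheses, the transverse entries of the
effective matrix vanish: `a^eff_{ij} = 0` for every pair `(i,j) ≠ (1,1)` (indices `(0,0)` in
Lean's 0-based numbering). -/
theorem aeff_transverse_vanish (d : ℕ) [NeZero d] (α : ℝ) (hα : 0 < α)
    (Box : Set (Fin d → ℝ)) (hBox : IsOpen Box)
    (hBoxper : ∀ y, y ∈ Box ↔ y + Pi.single (0 : Fin d) (1:ℝ) ∈ Box)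
    (C : Set (Fin d → ℝ)) (hC : C = Box ∩ {y | y 0 ∈ Ico (0:ℝ) 1})
    (hCbdd : Bornology.IsBounded C)
    (ψ : (Fin d → ℝ) → ℝ) (hψcont : Continuous ψ)
    (hψper : ∀ y, ψ (y + Pi.single (0 : Fin d) (1:ℝ)) = ψ y)
    (hψpos : ∀ y ∈ Box, 0 < ψ y) (hψzero : ∀ y ∉ Box, ψ y = 0)
    (A : (Fin d → ℝ) → Fin d → Fin d → ℝ)
    (hAper : ∀ y i j, A (y + Pi.single (0 : Fin d) (1:ℝ)) i j = A y i j)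
    (hAsym : ∀ y i j, A y i j = A y j i)
    (hAmeas : Measurable A) (M : ℝ) (hAbdd : ∀ y i j, |A y i j| ≤ M)
    (hell : ∀ y (ξ : Fin d → ℝ), α * ∑ i, ξ i ^ 2 ≤ ∑ i, ∑ j, A y i j * ξ i * ξ j)
    (N : Fin d → (Fin d → ℝ) → ℝ)
    (hNC1 : ∀ k, ContDiffOn ℝ 1 (N k) Box)
    (hNper : ∀ k y, N k (y + Pi.single (0 : Fin d) (1:ℝ)) = N k y)
    (hNint : ∀ k, IntegrableOn
      (fun y => ψ y ^ 2 * ((N k y) ^ 2 + ∑ j, fderiv ℝ (N k) y (Pi.single j 1) ^ 2)) C)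
    (hNweak : ∀ k, ∀ φ : (Fin d → ℝ) → ℝ, ContDiffOn ℝ 1 φ Box →
      (∀ y, φ (y + Pi.single (0 : Fin d) (1:ℝ)) = φ y) →
      IntegrableOn (fun y => ψ y ^ 2 * ((φ y) ^ 2 + ∑ j, fderiv ℝ φ y (Pi.single j 1) ^ 2)) C →
      ∫ y in C, ψ y ^ 2 * ∑ i, ∑ j, A y i j *
          fderiv ℝ (N k) y (Pi.single j 1) * fderiv ℝ φ y (Pi.single i 1)
        = -∫ y in C, ∑ j, ψ y ^ 2 * A y k j * fderiv ℝ φ y (Pi.single j 1)) :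
    ∀ i j : Fin d, ¬(i = 0 ∧ j = 0) → aeff d ψ A N C i j = 0 := by
  have hsplit := aeff_eq_add hCbdd hψcont hAmeas hAbdd hNint
  have hrow : ∀ i j : Fin d, i ≠ 0 → aeff d ψ A N C i j = 0 := by
    intro i j hi
    have hfd : ∀ y : Fin d → ℝ, fderiv ℝ (fun y : Fin d → ℝ => y i) y =
        ContinuousLinearMap.proj (R := ℝ) (φ := fun _ : Fin d => ℝ) i := fun y =>
      (ContinuousLinearMap.proj (R := ℝ) (φ := fun _ : Fin d => ℝ) i).fderiv
    have h := hNweak j (fun y => y i) (contDiff_apply ℝ ℝ i).contDiffOn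
      (fun y => by simp [hi]) (by
        simp only [hfd]
        exact Continuous.integrableOn_of_isBounded (by fun_prop) hCbdd)
    simp only [hfd, ContinuousLinearMap.proj_apply, Pi.single_apply, mul_ite, mul_one,
      mul_zero, Finset.sum_ite_eq, Finset.mem_univ, if_true] at h
    have hflux : ∫ y in C, ∑ k, ψ y ^ 2 * A y i k * fderiv ℝ (N j) y (Pi.single k 1) =
        -∫ y in C, ψ y ^ 2 * A y i j := by
      simp only [hAsym _ i j]
      rw [← h]
      congr 1 with y
      rw [Finset.sum_comm]
      simp [Finset.mul_sum, mul_assoc]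
    rw [hsplit, hflux, add_neg_cancel]
  have hsymm : ∀ i j : Fin d, aeff d ψ A N C i j = aeff d ψ A N C j i := by
    intro i j
    have hij := hNweak i (N j) (hNC1 j) (hNper j) (hNint j)
    have hji := hNweak j (N i) (hNC1 i) (hNper i) (hNint i)
    have henergy : ∫ y in C, ψ y ^ 2 * ∑ k, ∑ l, A y k l *
          fderiv ℝ (N i) y (Pi.single l 1) * fderiv ℝ (N j) y (Pi.single k 1) =
        ∫ y in C, ψ y ^ 2 * ∑ k, ∑ l, A y k l *
          fderiv ℝ (N j) y (Pi.single l 1) * fderiv ℝ (N i) y (Pi.single k 1) := by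
      congr 1 with y
      rw [Finset.sum_comm]
      congr 1
      refine Finset.sum_congr rfl fun k _ => Finset.sum_congr rfl fun l _ => ?_
      rw [hAsym y l k]
      ring
    rw [hsplit, hsplit, ← neg_inj.mp (hij.symm.trans (henergy.trans hji))]
    simp only [hAsym _ i j]
  intro i j hij
  by_cases hi : i = 0
  · rw [hsymm]
    exact hrow j i fun hj => hij ⟨hi, hj⟩
  · exact hrow i j hi
end
end

section
/- Under the weighted corrector hypotheses, and assuming in addition that □ is connected and C has positive Lebesgue measure, the longitudinal effective coefficient is strictly positive: a^eff_{11} := ∫_C Σ_{k=1}^d ψ(y)² a_{1k}(y)(δ_{k1} + ∂_{y_k}N_1(y)) dy satisfies a^eff_{11} ≥ α ∫_C ψ(y)² |e₁ + ∇N_1(y)|² dy > 0, where e₁ is the first standard basis vector. -/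
open MeasureTheory Set

noncomputable section

/-- A nonempty open set invariant under translation by the first basis vector meets the unit slab
`0 ≤ y₀ < 1` in a set of positive measure. -/
theorem volume_inter_slab_pos {d : ℕ} [NeZero d] {E : Set (Fin d → ℝ)} (hE : IsOpen E)
    (hne : E.Nonempty) (hper : ∀ y, y ∈ E ↔ y + Pi.single (0 : Fin d) (1 : ℝ) ∈ E) :
    0 < volume (E ∩ {y | y 0 ∈ Ico (0 : ℝ) 1}) := by
  have hperZ : ∀ n : ℤ, ∀ y, y ∈ E ↔ y + n • Pi.single (0 : Fin d) (1 : ℝ) ∈ E := by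
    intro n
    induction n with
    | zero => simp
    | succ n ih =>
      intro y
      rw [ih y, hper, add_zsmul, one_zsmul, add_assoc]
    | pred n ih =>
      intro y
      rw [ih y, hper (y + (-(n : ℤ) - 1) • _), sub_zsmul, one_zsmul, add_assoc, neg_add_cancel_right]
  refine pos_iff_ne_zero.2 fun h0 => (hE.measure_pos volume hne).ne' ?_
  have hcover : E ⊆ ⋃ n : ℤ, (fun y => y + n • Pi.single (0 : Fin d) (1 : ℝ)) ⁻¹'
      (E ∩ {y | y 0 ∈ Ico (0 : ℝ) 1}) := by
    intro y hy
    refine mem_iUnion.2 ⟨-⌊y 0⌋, (hperZ _ y).1 hy, ?_⟩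
    have h1 := Int.floor_le (y 0)
    have h2 := Int.lt_floor_add_one (y 0)
    have hcoord : (y + (-⌊y 0⌋) • (Pi.single 0 1 : Fin d → ℝ)) 0 = y 0 - ⌊y 0⌋ := by
      rw [Pi.add_apply, Pi.smul_apply, Pi.single_eq_same, zsmul_eq_mul]
      push_cast
      ring
    simp only [mem_ofPred_eq, hcoord]
    constructor <;> linarith
  refine measure_mono_null hcover (measure_iUnion_null fun n => ?_)
  rw [measure_preimage_add_right, h0]

/-- The function `y₀ + f y` with `f` periodic in the first variable cannot have vanishing gradient
throughout a connected open periodic set. -/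
theorem exists_single_add_fderiv_ne_zero {d : ℕ} [NeZero d] {U : Set (Fin d → ℝ)}
    (hU : IsOpen U) (hconn : IsConnected U)
    (hper : ∀ y, y ∈ U ↔ y + Pi.single (0 : Fin d) (1 : ℝ) ∈ U)
    {f : (Fin d → ℝ) → ℝ} (hf : DifferentiableOn ℝ f U)
    (hfper : ∀ y, f (y + Pi.single (0 : Fin d) (1 : ℝ)) = f y) :
    ∃ y ∈ U, ∃ p, (if p = (0 : Fin d) then (1 : ℝ) else 0) + fderiv ℝ f y (Pi.single p 1) ≠ 0 := by
  by_contra! h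
  obtain ⟨y, hy⟩ := hconn.nonempty
  have hcoord : Differentiable ℝ fun y : Fin d → ℝ => y 0 := differentiable_apply 0
  have hconst := hU.is_const_of_fderiv_eq_zero (𝕜 := ℝ) (f := fun y => y 0 + f y)
    hconn.isPreconnected (hcoord.differentiableOn.add hf) ?_ hy ((hper y).1 hy)
  · simp [hfper] at hconst
  · intro z hz
    have hfz : DifferentiableAt ℝ f z := (hf z hz).differentiableAt (hU.mem_nhds hz)
    rw [fderiv_fun_add (hcoord z) hfz]
    have hproj : fderiv ℝ (fun y : Fin d → ℝ => y 0) z = ContinuousLinearMap.proj 0 :=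
      (ContinuousLinearMap.proj (R := ℝ) (φ := fun _ : Fin d => ℝ) 0).fderiv
    rw [hproj]
    refine ContinuousLinearMap.coe_injective (LinearMap.pi_ext' fun p => LinearMap.ext_ring ?_)
    simpa [Pi.single_apply, eq_comm] using h z hz p

/-- Expansion of a symmetric quadratic form at a basis vector plus `g`. -/
theorem sum_sum_single_add {d : ℕ} (a : Fin d → Fin d → ℝ) (ha : ∀ i j, a i j = a j i)
    (o : Fin d) (g : Fin d → ℝ) :
    ∑ i, ∑ j, a i j * ((if i = o then (1 : ℝ) else 0) + g i) *
        ((if j = o then (1 : ℝ) else 0) + g j)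
      = a o o + 2 * ∑ j, a o j * g j + ∑ i, ∑ j, a i j * g j * g i := by
  have h : ∀ i j, a i j * ((if i = o then (1 : ℝ) else 0) + g i) *
        ((if j = o then (1 : ℝ) else 0) + g j)
      = (if i = o then (if j = o then a i j else 0) else 0) + (if i = o then a i j * g j else 0)
        + (if j = o then a i j * g i else 0) + a i j * g j * g i := by
    intro i j
    split_ifs <;> ring
  have hsymm : ∑ i, a i o * g i = ∑ i, a o i * g i :=
    Finset.sum_congr rfl fun i _ => by rw [ha i o]
  have hrow : ∑ i, ∑ j, (if i = o then a i j * g j else 0) = ∑ j, a o j * g j := by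
    rw [Finset.sum_comm]; simp
  have hdiag : ∑ i, ∑ j, (if i = o then (if j = o then a i j else 0) else 0) = a o o := by
    rw [Finset.sum_comm]; simp
  simp only [h, Finset.sum_add_distrib, hrow, hdiag]
  simp only [Finset.sum_ite_eq', Finset.mem_univ, if_true, hsymm]
  ring

/-- Under the weighted corrector hypotheses, if moreover the periodic open
set is connected and the cell has positive measure, the longitudinal effective coefficient is
strictly positive: `a^eff_{11} ≥ α ∫_C ψ² |e₁ + ∇N₁|² dy > 0`. -/
theorem aeff_one_one_positive (d : ℕ) [NeZero d] (α : ℝ) (hα : 0 < α)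
    (Box : Set (Fin d → ℝ)) (hBox : IsOpen Box)
    (hBoxper : ∀ y, y ∈ Box ↔ y + Pi.single (0 : Fin d) (1:ℝ) ∈ Box)
    (C : Set (Fin d → ℝ)) (hC : C = Box ∩ {y | y 0 ∈ Ico (0:ℝ) 1})
    (hCbdd : Bornology.IsBounded C)
    (ψ : (Fin d → ℝ) → ℝ) (hψcont : Continuous ψ)
    (hψper : ∀ y, ψ (y + Pi.single (0 : Fin d) (1:ℝ)) = ψ y)
    (hψpos : ∀ y ∈ Box, 0 < ψ y) (hψzero : ∀ y ∉ Box, ψ y = 0)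
    (A : (Fin d → ℝ) → Fin d → Fin d → ℝ)
    (hAper : ∀ y i j, A (y + Pi.single (0 : Fin d) (1:ℝ)) i j = A y i j)
    (hAsym : ∀ y i j, A y i j = A y j i)
    (hAmeas : Measurable A) (M : ℝ) (hAbdd : ∀ y i j, |A y i j| ≤ M)
    (hell : ∀ y (ξ : Fin d → ℝ), α * ∑ i, ξ i ^ 2 ≤ ∑ i, ∑ j, A y i j * ξ i * ξ j)
    (N : Fin d → (Fin d → ℝ) → ℝ)
    (hNC1 : ∀ k, ContDiffOn ℝ 1 (N k) Box)
    (hNper : ∀ k y, N k (y + Pi.single (0 : Fin d) (1:ℝ)) = N k y)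
    (hNint : ∀ k, IntegrableOn
      (fun y => ψ y ^ 2 * ((N k y) ^ 2 + ∑ j, fderiv ℝ (N k) y (Pi.single j 1) ^ 2)) C)
    (hNweak : ∀ k, ∀ φ : (Fin d → ℝ) → ℝ, ContDiffOn ℝ 1 φ Box →
      (∀ y, φ (y + Pi.single (0 : Fin d) (1:ℝ)) = φ y) →
      IntegrableOn (fun y => ψ y ^ 2 * ((φ y) ^ 2 + ∑ j, fderiv ℝ φ y (Pi.single j 1) ^ 2)) C →
      ∫ y in C, ψ y ^ 2 * ∑ i, ∑ j, A y i j *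
          fderiv ℝ (N k) y (Pi.single j 1) * fderiv ℝ φ y (Pi.single i 1)
        = -∫ y in C, ∑ j, ψ y ^ 2 * A y k j * fderiv ℝ φ y (Pi.single j 1))
    (hconn : IsConnected Box) (hCpos : 0 < volume C) :
    α * (∫ y in C, ψ y ^ 2 *
        ∑ p, ((if p = (0 : Fin d) then (1:ℝ) else 0) + fderiv ℝ (N 0) y (Pi.single p 1)) ^ 2)
      ≤ aeff d ψ A N C 0 0 ∧
    0 < α * (∫ y in C, ψ y ^ 2 *
        ∑ p, ((if p = (0 : Fin d) then (1:ℝ) else 0) + fderiv ℝ (N 0) y (Pi.single p 1)) ^ 2) := by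
  set g : (Fin d → ℝ) → Fin d → ℝ := fun y p => fderiv ℝ (N 0) y (Pi.single p 1) with hg
  have hgmeas : ∀ p, Measurable fun y => g y p := fun p => measurable_fderiv_apply_const ℝ (N 0) _
  have hAm : ∀ i j, Measurable fun y => A y i j := fun i j =>
    (measurable_pi_apply j).comp ((measurable_pi_apply i).comp hAmeas)
  have hψm : Measurable ψ := hψcont.measurable
  have hM : 0 ≤ M := (abs_nonneg _).trans (hAbdd 0 0 0)
  have hψint : IntegrableOn (fun y => ψ y ^ 2) C :=
    ((hψcont.pow 2).continuousOn.integrableOn_compact hCbdd.isCompact_closure).mono_set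
      subset_closure
  have hgrad : IntegrableOn (fun y => ψ y ^ 2 * ∑ p, g y p ^ 2) C := by
    refine (hNint 0).mono' (by fun_prop) (.of_forall fun y => ?_)
    have hsum : 0 ≤ ∑ p, g y p ^ 2 := Finset.sum_nonneg fun p _ => sq_nonneg _
    rw [Real.norm_of_nonneg (by positivity)]
    exact mul_le_mul_of_nonneg_left (le_add_of_nonneg_left (sq_nonneg _)) (sq_nonneg _)
  have hdom : IntegrableOn (fun y => M * (ψ y ^ 2 * (1 + ∑ p, g y p ^ 2))) C := by
    refine ((hψint.add hgrad).const_mul M).congr (.of_forall fun y => ?_)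
    simp only [Pi.add_apply]
    ring
  have hbound : ∀ c : (Fin d → ℝ) → ℝ, Measurable c → ∀ i j,
      (∀ y, |c y| ≤ 1 + ∑ p, g y p ^ 2) →
      IntegrableOn (fun y => ψ y ^ 2 * (A y i j * c y)) C := by
    intro c hc i j hcle
    have hAij := hAm i j
    refine hdom.mono' (by fun_prop) (.of_forall fun y => ?_)
    rw [Real.norm_eq_abs, abs_mul, abs_mul, abs_of_nonneg (sq_nonneg (ψ y))]
    calc ψ y ^ 2 * (|A y i j| * |c y|) ≤ ψ y ^ 2 * (M * (1 + ∑ p, g y p ^ 2)) := by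
          gcongr
          · exact hAbdd y i j
          · exact hcle y
      _ = M * (ψ y ^ 2 * (1 + ∑ p, g y p ^ 2)) := by ring
  have hsq : ∀ y p, g y p ^ 2 ≤ ∑ p, g y p ^ 2 := fun y p =>
    Finset.single_le_sum (f := fun p => g y p ^ 2) (fun p _ => sq_nonneg _) (Finset.mem_univ p)
  have hdiag : IntegrableOn (fun y => ψ y ^ 2 * A y 0 0) C := by
    simpa using hbound (fun _ => 1) measurable_const 0 0 fun y => by
      simpa using Finset.sum_nonneg fun p _ => sq_nonneg (g y p)
  have hlin : IntegrableOn (fun y => ∑ j, ψ y ^ 2 * A y 0 j * g y j) C := by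
    refine integrable_finsetSum _ fun j _ => ?_
    refine (hbound (fun y => g y j) (hgmeas j) 0 j fun y => ?_).congr
      (.of_forall fun y => (mul_assoc _ _ _).symm)
    have := hsq y j
    rw [abs_le]
    constructor <;> nlinarith [sq_nonneg (g y j - 1), sq_nonneg (g y j + 1)]
  have hquad : IntegrableOn (fun y => ψ y ^ 2 * ∑ i, ∑ j, A y i j * g y j * g y i) C := by
    simp only [Finset.mul_sum]
    refine integrable_finsetSum _ fun i _ => integrable_finsetSum _ fun j _ => ?_
    refine (hbound (fun y => g y j * g y i) ((hgmeas j).mul (hgmeas i)) i j fun y => ?_).congr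
      (.of_forall fun y => by simp only [mul_assoc])
    have := hsq y j
    have := hsq y i
    rw [abs_le]
    constructor <;> nlinarith [sq_nonneg (g y j - g y i), sq_nonneg (g y j + g y i)]
  have hweak : ∫ y in C, ψ y ^ 2 * ∑ i, ∑ j, A y i j * g y j * g y i
      = -∫ y in C, ∑ j, ψ y ^ 2 * A y 0 j * g y j :=
    hNweak 0 (N 0) (hNC1 0) (hNper 0) (hNint 0)
  have haeff : aeff d ψ A N C 0 0
      = (∫ y in C, ψ y ^ 2 * A y 0 0) + ∫ y in C, ∑ j, ψ y ^ 2 * A y 0 j * g y j := by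
    rw [← integral_add hdiag hlin, aeff]
    refine integral_congr_ae (.of_forall fun y => ?_)
    simp [mul_add, Finset.sum_add_distrib, hg]
  set S : (Fin d → ℝ) → ℝ :=
    fun y => ∑ p, ((if p = (0 : Fin d) then (1 : ℝ) else 0) + g y p) ^ 2 with hS
  have hSnonneg : ∀ y, 0 ≤ S y := fun y => Finset.sum_nonneg fun p _ => sq_nonneg _
  have hSint : IntegrableOn (fun y => ψ y ^ 2 * S y) C := by
    refine (((hψint.add hgrad).const_mul 2).mono' (by fun_prop) (.of_forall fun y => ?_))
    rw [Real.norm_of_nonneg (mul_nonneg (sq_nonneg _) (hSnonneg y))]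
    have hle : S y ≤ 2 * (1 + ∑ p, g y p ^ 2) := by
      calc S y ≤ ∑ p, (2 * (if p = (0 : Fin d) then (1 : ℝ) else 0) + 2 * g y p ^ 2) := by
            refine Finset.sum_le_sum fun p _ => ?_
            split_ifs <;> nlinarith [sq_nonneg (g y p - 1)]
        _ = 2 * (1 + ∑ p, g y p ^ 2) := by
            simp [Finset.sum_add_distrib, ← Finset.mul_sum, mul_add]
    calc ψ y ^ 2 * S y ≤ ψ y ^ 2 * (2 * (1 + ∑ p, g y p ^ 2)) :=
          mul_le_mul_of_nonneg_left hle (sq_nonneg _)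
      _ = 2 * (ψ y ^ 2 + ψ y ^ 2 * ∑ p, g y p ^ 2) := by ring
  have hdiaglin : IntegrableOn
      (fun y => ψ y ^ 2 * A y 0 0 + 2 * ∑ j, ψ y ^ 2 * A y 0 j * g y j) C :=
    hdiag.add (hlin.const_mul 2)
  refine ⟨?_, mul_pos hα ?_⟩
  · have hsplit : ∫ y in C, (ψ y ^ 2 * A y 0 0 + 2 * (∑ j, ψ y ^ 2 * A y 0 j * g y j)
        + ψ y ^ 2 * ∑ i, ∑ j, A y i j * g y j * g y i) = aeff d ψ A N C 0 0 := by
      rw [integral_add hdiaglin hquad,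
        integral_add hdiag (hlin.const_mul 2), integral_const_mul, hweak, haeff]
      ring
    rw [← hsplit, ← integral_const_mul]
    refine integral_mono (hSint.const_mul α) (hdiaglin.add hquad) fun y => ?_
    have hexp := sum_sum_single_add (A y) (hAsym y) 0 (g y)
    calc α * (ψ y ^ 2 * S y) = ψ y ^ 2 * (α * S y) := by ring
      _ ≤ ψ y ^ 2 * (A y 0 0 + 2 * ∑ j, A y 0 j * g y j
            + ∑ i, ∑ j, A y i j * g y j * g y i) := by
          rw [← hexp]
          exact mul_le_mul_of_nonneg_left (hell y _) (sq_nonneg _)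
      _ = _ := by
          simp only [mul_assoc (ψ y ^ 2) (A y 0 _), ← Finset.mul_sum]
          ring
  · rw [setIntegral_pos_iff_support_of_nonneg_ae
      (.of_forall fun y => mul_nonneg (sq_nonneg _) (hSnonneg y)) hSint]
    have hgcont : ∀ p, ContinuousOn (fun y => g y p) Box := fun p =>
      ((hNC1 0).continuousOn_fderiv_of_isOpen hBox le_rfl).clm_apply continuousOn_const
    have hScont : ContinuousOn S Box := by
      refine continuousOn_finsetSum _ fun p _ => (continuousOn_const.add (hgcont p)).pow 2
    have hSper : ∀ y, S (y + Pi.single (0 : Fin d) (1 : ℝ)) = S y := by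
      intro y
      have hder : fderiv ℝ (N 0) (y + Pi.single (0 : Fin d) (1 : ℝ)) = fderiv ℝ (N 0) y := by
        rw [← fderiv_comp_add_right]
        simp only [hNper]
      simp only [hS, hg, hder]
    obtain ⟨y, hy, p, hp⟩ := exists_single_add_fderiv_ne_zero hBox hconn hBoxper
      ((hNC1 0).differentiableOn one_ne_zero) (hNper 0)
    have hne : (Box ∩ S ⁻¹' {0}ᶜ).Nonempty := by
      refine ⟨y, hy, fun h0 => hp ?_⟩
      have := (Finset.sum_eq_zero_iff_of_nonneg fun p _ => sq_nonneg _).1 h0 p (Finset.mem_univ p)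
      exact pow_eq_zero_iff two_ne_zero |>.1 this
    refine (volume_inter_slab_pos (hScont.isOpen_inter_preimage hBox isOpen_compl_singleton) hne
      fun z => ?_).trans_le (measure_mono ?_)
    · simp only [mem_inter_iff, mem_preimage, hSper, ← hBoxper]
    · rintro z ⟨⟨hz, hSz⟩, hslab⟩
      exact ⟨mul_ne_zero (pow_ne_zero 2 (hψpos z hz).ne') hSz, hC ▸ ⟨hz, hslab⟩⟩
end
end
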